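/- arXiv:2308.10595 — 8 statements merged into one kernel-verified Lean document; each statement's English description precedes it below -/
import Mathlib

section
/- Let p : E → B be a continuous map of topological spaces with B metrizable. Suppose U_0, …, U_k are open subsets of B whose union is B and that for each i = 0, …, k there is a continuous map s_i : U_i → E with p(s_i(b)) = b for all b ∈ U_i. Then there exist pairwise disjoint subsets A_0, …, A_k of B whose union is B such that the closure of A_i is contained in ∪_{j ≥ i} A_j for every i, and such that for each i there is a continuous map σ_i : A_i → E (A_i carrying the subspace topology) with p(σ_i(b)) = b for all b ∈ A_i. -/
/-- **Partition lemma (Lemma 2.6).**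
Let `p : E → B` be a continuous map with `B` metrizable. Given a finite open cover
`U 0, …, U k` of `B` such that each `U i` admits a continuous partial section of `p`,
there exists a partition `A 0, …, A k` of `B` into pairwise disjoint sets with
`closure (A i) ⊆ ⋃_{j ≥ i} A j` for every `i`, each of which admits a continuous
partial section of `p`. -/
theorem partition_lemma_for_sections
    {E B : Type*} [TopologicalSpace E] [TopologicalSpace B]
    [TopologicalSpace.MetrizableSpace B]
    (p : E → B) (hp : Continuous p) (k : ℕ) (U : Fin (k + 1) → Set B)
    (hUopen : ∀ i, IsOpen (U i)) (hUcover : ⋃ i, U i = Set.univ)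
    (s : ∀ i, (U i) → E) (hscont : ∀ i, Continuous (s i))
    (hssec : ∀ i (b : U i), p (s i b) = (b : B)) :
    ∃ A : Fin (k + 1) → Set B,
      Pairwise (Function.onFun Disjoint A) ∧
      (⋃ i, A i = Set.univ) ∧
      (∀ i, closure (A i) ⊆ ⋃ j, ⋃ (_ : i ≤ j), A j) ∧
      (∀ i, ∃ σ : (A i) → E, Continuous σ ∧ ∀ b : A i, p (σ b) = (b : B)) := by
  have hfirst (b : B) : ∃ m, b ∈ U m ∧ ∀ j < m, b ∉ U j := by
    obtain ⟨n, hn⟩ := Set.mem_iUnion.mp (hUcover ▸ Set.mem_univ b)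
    obtain ⟨m, hm, hmin⟩ := wellFounded_lt.has_min {i | b ∈ U i} ⟨n, hn⟩
    exact ⟨m, hm, fun j hj hbj => hmin j hbj hj⟩
  refine ⟨fun i => {b | b ∈ U i ∧ ∀ j < i, b ∉ U j}, ?_, ?_, ?_, ?_⟩
  · intro i j hij
    refine Set.disjoint_left.mpr fun b hi hj => ?_
    rcases hij.lt_or_gt with h | h
    · exact hj.2 i h hi.1
    · exact hi.2 j h hj.1
  · exact Set.eq_univ_of_forall fun b => Set.mem_iUnion.mpr (hfirst b)
  · intro i b hb
    have hclosed : IsClosed (⋂ j, ⋂ (_ : j < i), (U j)ᶜ) :=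
      isClosed_iInter fun j => isClosed_iInter fun _ => (hUopen j).isClosed_compl
    have hbi : b ∈ ⋂ j, ⋂ (_ : j < i), (U j)ᶜ :=
      closure_minimal (fun x hx => Set.mem_iInter₂.mpr hx.2) hclosed hb
    obtain ⟨m, hm, hmin⟩ := hfirst b
    exact Set.mem_iUnion₂.mpr
      ⟨m, not_lt.mp fun h => Set.mem_iInter₂.mp hbi m h hm, hm, hmin⟩
  · intro i
    exact ⟨fun b => s i ⟨b, b.2.1⟩,
      (hscont i).comp (continuous_subtype_val.subtype_mk fun b => b.2.1), fun b => hssec i _⟩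
end

section
/- Let B be a topological space and let U_0, …, U_k be open subsets of B whose union is B. For b ∈ B let μ(b) denote the number of indices i ∈ {0, …, k} with b ∈ U_i. Then for every integer m the set {b ∈ B : μ(b) ≥ m} is open in B. Consequently, setting A_i = {b ∈ B : μ(b) = k + 1 − i} for 0 ≤ i ≤ k, the sets A_0, …, A_k are pairwise disjoint, their union is B, and the closure of A_i is contained in ∪_{j ≥ i} A_j for every i. -/
/-- The multiplicity function of a finite family of open sets is lower semicontinuous. -/
theorem isOpen_setOf_le_card_mem {ι B : Type*} [Finite ι] [TopologicalSpace B]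
    {U : ι → Set B} (hU : ∀ i, IsOpen (U i)) (m : ℕ) :
    IsOpen {b : B | m ≤ Nat.card {j : ι // b ∈ U j}} := by
  rw [isOpen_iff_mem_nhds]
  intro b hb
  have h_near : ∀ᶠ c in nhds b, ∀ j, b ∈ U j → c ∈ U j :=
    Filter.eventually_all.2 fun j => by
      by_cases hj : b ∈ U j
      · filter_upwards [(hU j).mem_nhds hj] with c hc _ using hc
      · exact Filter.Eventually.of_forall fun c h => absurd h hj
  filter_upwards [h_near] with c hc
  exact le_trans hb <|
    Nat.card_le_card_of_injective _ (Subtype.map_injective hc Function.injective_id)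

/-- For a finite open cover `U 0, …, U k` of a topological space `B`, let
`μ b = Nat.card {i // b ∈ U i}` be the number of members of the cover containing `b`.
Then each superlevel set `{b | μ b ≥ m}` is open; consequently, the sets
`A i = {b | μ b = k + 1 - i}` are pairwise disjoint, cover `B`, and satisfy
`closure (A i) ⊆ ⋃_{j ≥ i} A j`. -/
theorem multiplicity_partition_of_open_cover
    {B : Type*} [TopologicalSpace B] (k : ℕ) (U : Fin (k + 1) → Set B)
    (hUopen : ∀ i, IsOpen (U i)) (hUcover : ⋃ i, U i = Set.univ)
    (A : Fin (k + 1) → Set B)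
    (hA : ∀ i, A i = {b : B | Nat.card {j : Fin (k + 1) // b ∈ U j} = k + 1 - (i : ℕ)}) :
    (∀ m : ℕ, IsOpen {b : B | m ≤ Nat.card {j : Fin (k + 1) // b ∈ U j}}) ∧
    Pairwise (Function.onFun Disjoint A) ∧
    (⋃ i, A i = Set.univ) ∧
    (∀ i, closure (A i) ⊆ ⋃ j, ⋃ (_ : i ≤ j), A j) := by
  have h_open := isOpen_setOf_le_card_mem hUopen
  have h_cover : ⋃ i, A i = Set.univ := by
    refine Set.eq_univ_of_forall fun b => ?_
    obtain ⟨j, hj⟩ := Set.mem_iUnion.1 (hUcover ▸ Set.mem_univ b)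
    have : Nonempty {j : Fin (k + 1) // b ∈ U j} := ⟨⟨j, hj⟩⟩
    have h_pos : 0 < Nat.card {j : Fin (k + 1) // b ∈ U j} := Nat.card_pos
    have h_le : Nat.card {j : Fin (k + 1) // b ∈ U j} ≤ k + 1 := by
      simpa using Finite.card_subtype_le (fun j => b ∈ U j)
    refine Set.mem_iUnion.2 ⟨⟨k + 1 - Nat.card {j : Fin (k + 1) // b ∈ U j}, by omega⟩, ?_⟩
    rw [hA, Set.mem_ofPred_eq]
    dsimp only
    omega
  refine ⟨h_open, ?_, h_cover, ?_⟩
  · intro i j hij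
    rw [Function.onFun, Set.disjoint_left]
    intro b hi hj
    rw [hA, Set.mem_ofPred_eq] at hi hj
    exact hij (Fin.ext (by omega))
  · intro i b hb
    have h_le : Nat.card {j : Fin (k + 1) // b ∈ U j} ≤ k + 1 - (i : ℕ) := by
      have h_sub : A i ⊆
          {b : B | k + 1 - (i : ℕ) + 1 ≤ Nat.card {j : Fin (k + 1) // b ∈ U j}}ᶜ := by
        intro c hc
        rw [hA, Set.mem_ofPred_eq] at hc
        rw [Set.mem_compl_iff, Set.mem_ofPred_eq]
        omega
      have h_mem := closure_minimal h_sub (h_open _).isClosed_compl hb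
      rw [Set.mem_compl_iff, Set.mem_ofPred_eq] at h_mem
      omega
    obtain ⟨j, hj⟩ := Set.mem_iUnion.1 (h_cover ▸ Set.mem_univ b)
    refine Set.mem_iUnion₂.2 ⟨j, ?_, hj⟩
    rw [hA, Set.mem_ofPred_eq] at hj
    rw [Fin.le_def]
    omega
end

section
/- Let B be a topological space and let U_0, …, U_k be open subsets of B. For a subset S ⊆ {0, …, k} let U_S = ∩_{i ∈ S} U_i (with U_∅ = B), and define U'_S = U_S \ ∪_{T ⊆ {0,…,k}, |T| > |S|} U_T. Then for any two subsets S ≠ S' of {0, …, k} with |S| = |S'|, the closure of U'_S is disjoint from U'_{S'}. -/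
/-- For a finite family of open sets `U 0, …, U k` in a topological space `B`, let
`U_S = ⋂_{i ∈ S} U i` (with `U_∅ = B`) for `S ⊆ {0, …, k}`, and
`U'_S = U_S \ ⋃_{|T| > |S|} U_T`.  Then for `S ≠ S'` with `|S| = |S'|`, the closure of
`U'_S` is disjoint from `U'_{S'}`. -/
theorem closure_disjoint_of_equal_multiplicity
    {B : Type*} [TopologicalSpace B] (k : ℕ) (U : Fin (k + 1) → Set B)
    (hUopen : ∀ i, IsOpen (U i))
    (U' : Finset (Fin (k + 1)) → Set B)
    (hU' : ∀ S : Finset (Fin (k + 1)),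
      U' S = (⋂ i ∈ S, U i) \
        ⋃ (T : Finset (Fin (k + 1))) (_ : S.card < T.card), ⋂ i ∈ T, U i) :
    ∀ S S' : Finset (Fin (k + 1)), S ≠ S' → S.card = S'.card →
      Disjoint (closure (U' S)) (U' S') := by
  intro S S' hne hcard
  have hlt : S.card < (S ∪ S').card := by
    refine Finset.card_lt_card (Finset.subset_union_left.ssubset_of_ne fun h => hne ?_)
    exact (Finset.eq_of_subset_of_card_le (Finset.union_eq_left.mp h.symm) hcard.le).symm
  have hopen : IsOpen (⋂ i ∈ S', U i) := isOpen_biInter_finset fun i _ => hUopen i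
  have hdisj : Disjoint (U' S) (⋂ i ∈ S', U i) := by
    rw [Set.disjoint_left, hU']
    rintro x ⟨hxS, hx⟩ hxS'
    refine hx (Set.mem_iUnion₂.mpr ⟨S ∪ S', hlt, ?_⟩)
    rw [Finset.set_biInter_inter]
    exact ⟨hxS, hxS'⟩
  refine (hdisj.closure_left hopen).mono_right ?_
  rw [hU']
  exact Set.sdiff_subset
end

section
/- Let p : E → B be a continuous map of topological spaces, let K be a nonempty path-connected metrizable space, let k_1, …, k_r ∈ K be pairwise distinct points, and let 0 ≤ t_1 < t_2 < … < t_r ≤ 1 be real numbers. Let Π^K : E^K_B → E^r_B be the evaluation map Π^K(α) = (α(k_1), …, α(k_r)) and let Π^I : E^I_B → E^r_B (where I = [0,1]) be the evaluation map Π^I(β) = (β(t_1), …, β(t_r)). Then for every subset U ⊆ E^r_B the following are equivalent: (i) there exists a continuous map s : U → E^K_B with Π^K(s(x)) = x for all x ∈ U; (ii) there exists a continuous map s' : U → E^I_B with Π^I(s'(x)) = x for all x ∈ U. In particular the sectional categories of Π^K and Π^I coincide. -/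
/-- A continuous curve in a path-connected space can be made to take prescribed values at
finitely many increasing times. -/
theorem exists_continuous_real_interpolation {K : Type*} [TopologicalSpace K]
    [PathConnectedSpace K] {r : ℕ} (t : Fin r → ℝ) (ht : StrictMono t) (k : Fin r → K) :
    ∃ g : ℝ → K, Continuous g ∧ ∀ i, g (t i) = k i := by
  induction r with
  | zero =>
    obtain ⟨x⟩ := (inferInstance : Nonempty K)
    exact ⟨fun _ => x, continuous_const, fun i => i.elim0⟩
  | succ n ih =>
    obtain ⟨g, hg, hgk⟩ := ih (fun i => t i.castSucc)
      (ht.comp Fin.strictMono_castSucc) (fun i => k i.castSucc)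
    obtain ⟨c, hlt, hc⟩ := Order.exists_between_finsets
      (lo := Finset.univ.image fun i : Fin n => t i.castSucc) (hi := {t (Fin.last n)})
      (by simpa using fun i => ht (Fin.castSucc_lt_last i))
    replace hlt : ∀ i : Fin n, t i.castSucc < c := by simpa using hlt
    replace hc : c < t (Fin.last n) := by simpa using hc
    have γ : Path (g c) (k (Fin.last n)) := PathConnectedSpace.somePath _ _
    refine ⟨fun x => if x ≤ c then g x else γ.extend ((x - c) / (t (Fin.last n) - c)), ?_, ?_⟩
    · refine Continuous.if_le hg (γ.continuous_extend.comp (by fun_prop)) continuous_id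
        continuous_const ?_
      rintro x rfl
      simp
    · intro i
      induction i using Fin.lastCases with
      | last => simp [hc.not_ge, div_self (sub_pos.2 hc).ne']
      | cast i => simpa [(hlt i).le] using hgk i

/-- A finite injective family in a metrizable space can be mapped to any family of points of
`[0,1]` by a continuous function. -/
theorem exists_continuousMap_Icc_interpolation {K ι : Type*} [TopologicalSpace K]
    [TopologicalSpace.MetrizableSpace K] [Finite ι] (k : ι → K) (hk : Function.Injective k)
    (t : ι → Set.Icc (0 : ℝ) 1) : ∃ f : C(K, Set.Icc (0 : ℝ) 1), ∀ i, f (k i) = t i := by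
  let : TopologicalSpace ι := ⊥
  have : DiscreteTopology ι := ⟨rfl⟩
  let _ := TopologicalSpace.metrizableSpaceMetric K
  have he : Topology.IsClosedEmbedding k := continuous_of_discreteTopology.isClosedEmbedding hk
  obtain ⟨f, hf⟩ := ContinuousMap.exists_extension' he ⟨t, continuous_of_discreteTopology⟩
  exact ⟨f, congrFun hf⟩

/-- Precomposition with `f : X → Y`, as a map between spaces of maps into a fibre of `p`, turns
sections of an evaluation map on `Y` into sections of an evaluation map on `X`. -/
theorem exists_section_eval_of_continuousMap {E B X Y ι : Type*} [TopologicalSpace E]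
    [TopologicalSpace X] [TopologicalSpace Y] (p : E → B) (f : C(X, Y)) (x : ι → X) (y : ι → Y)
    (hf : ∀ i, f (x i) = y i) {U : Type*} [TopologicalSpace U] (v : U → ι → E)
    (h : ∃ s : U → {α : C(Y, E) // ∃ b : B, ∀ z : Y, p (α z) = b},
      Continuous s ∧ ∀ u i, (s u).1 (y i) = v u i) :
    ∃ s : U → {α : C(X, E) // ∃ b : B, ∀ z : X, p (α z) = b},
      Continuous s ∧ ∀ u i, (s u).1 (x i) = v u i := by
  obtain ⟨s, hs, hsv⟩ := h
  refine ⟨fun u => ⟨(s u).1.comp f, (s u).2.imp fun b hb z => hb (f z)⟩, ?_, fun u i => ?_⟩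
  · exact ((ContinuousMap.continuous_precomp f).comp
      (continuous_subtype_val.comp hs)).subtype_mk _
  · simp [hf, hsv]


/-- **Lemma 2.3.** Let `p : E → B` be continuous, `K` a nonempty path-connected
metrizable space with pairwise distinct points `kpt 1, …, kpt r`, and let
`0 ≤ t 1 < … < t r ≤ 1`.  Write `E^K_B` for the space of continuous maps `α : K → E`
(compact-open topology) with `p ∘ α` constant, `E^I_B` likewise for `I = [0,1]`, and
`E^r_B = {e : Fin r → E | p (e i) = p (e j)}`.  For every subset `U` of `E^r_B`, the
evaluation map `Π^K (α) = (α (kpt 1), …, α (kpt r))` admits a continuous section over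
`U` if and only if the evaluation map `Π^I (β) = (β (t 1), …, β (t r))` does.
(In particular the sectional categories of `Π^K` and `Π^I` coincide.) -/
theorem section_of_eval_K_iff_section_of_eval_I
    {E B K : Type*} [TopologicalSpace E] [TopologicalSpace B] [TopologicalSpace K]
    [Nonempty K] [PathConnectedSpace K] [TopologicalSpace.MetrizableSpace K]
    (p : E → B) (hp : Continuous p) (r : ℕ)
    (kpt : Fin r → K) (hkpt : Function.Injective kpt)
    (t : Fin r → ℝ) (ht : ∀ i, t i ∈ Set.Icc (0 : ℝ) 1) (htmono : StrictMono t)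
    (U : Set {e : Fin r → E // ∀ i j, p (e i) = p (e j)}) :
    (∃ s : U → {α : C(K, E) // ∃ b : B, ∀ x : K, p (α x) = b},
        Continuous s ∧ ∀ x : U, ∀ i : Fin r, (s x).1 (kpt i) = x.1.1 i) ↔
    (∃ s' : U → {β : C(Set.Icc (0 : ℝ) 1, E) // ∃ b : B, ∀ x : Set.Icc (0 : ℝ) 1, p (β x) = b},
        Continuous s' ∧ ∀ x : U, ∀ i : Fin r, (s' x).1 ⟨t i, ht i⟩ = x.1.1 i) := by
  obtain ⟨f, hf⟩ := exists_continuousMap_Icc_interpolation kpt hkpt fun i => ⟨t i, ht i⟩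
  obtain ⟨g, hg, hgk⟩ := exists_continuous_real_interpolation t htmono kpt
  exact ⟨exists_section_eval_of_continuousMap p ⟨fun x : Set.Icc (0 : ℝ) 1 => g x, hg.comp continuous_subtype_val⟩
      (fun i => ⟨t i, ht i⟩) kpt hgk (fun x : U => x.1.1),
    exists_section_eval_of_continuousMap p f kpt (fun i => ⟨t i, ht i⟩) hf
      (fun x : U => x.1.1)⟩
end

section
/- Let W be a topological space, let A_0, …, A_k be pairwise disjoint subsets of W whose union is W such that the closure of A_i is contained in ∪_{i' ≥ i} A_{i'} for every i, and let C_1, …, C_n be closed subsets of W. For 0 ≤ i ≤ k and J ⊆ {1, …, n} define F^i_J = A_i ∩ (∩_{j ∈ J} C_j) ∩ (∩_{j ∉ J} (W \ C_j)). Then the closure of F^i_J is contained in the union of the sets F^{i'}_{J'} taken over all pairs (i', J') with i' ≥ i and J' ⊇ J. Consequently, if |J| + i = |J'| + i' and (i, J) ≠ (i', J'), then the closure of F^i_J is disjoint from F^{i'}_{J'}. -/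
/-- **Gluing lemma for the sets `F^i_J`.** Let `A 0, …, A k` be a partition of a
topological space `W` with `closure (A i) ⊆ ⋃_{i' ≥ i} A i'`, and let `C 1, …, C n` be
closed subsets of `W`.  For `J ⊆ {1, …, n}` set
`F i J = A i ∩ (⋂_{j ∈ J} C j) ∩ (⋂_{j ∉ J} (C j)ᶜ)`.  Then
`closure (F i J) ⊆ ⋃_{i' ≥ i, J' ⊇ J} F i' J'`; consequently if
`|J| + i = |J'| + i'` and `(i, J) ≠ (i', J')` then the closure of `F i J` is disjoint
from `F i' J'`. -/
theorem closure_refined_partition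
    {W : Type*} [TopologicalSpace W] (k n : ℕ)
    (A : Fin (k + 1) → Set W) (hdisj : Pairwise (Function.onFun Disjoint A))
    (hcover : ⋃ i, A i = Set.univ)
    (hclosure : ∀ i, closure (A i) ⊆ ⋃ i', ⋃ (_ : i ≤ i'), A i')
    (C : Fin n → Set W) (hC : ∀ j, IsClosed (C j))
    (F : Fin (k + 1) → Finset (Fin n) → Set W)
    (hF : ∀ i J, F i J =
      A i ∩ (⋂ j ∈ J, C j) ∩ (⋂ j, ⋂ (_ : j ∉ J), (C j)ᶜ)) :
    (∀ (i : Fin (k + 1)) (J : Finset (Fin n)),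
      closure (F i J) ⊆
        ⋃ (i' : Fin (k + 1)) (_ : i ≤ i') (J' : Finset (Fin n)) (_ : J ⊆ J'),
          F i' J') ∧
    (∀ (i i' : Fin (k + 1)) (J J' : Finset (Fin n)),
      J.card + (i : ℕ) = J'.card + (i' : ℕ) → (i, J) ≠ (i', J') →
      Disjoint (closure (F i J)) (F i' J')) := by
  classical
  have mem_F (w : W) (i : Fin (k + 1)) (J : Finset (Fin n)) :
      w ∈ F i J ↔ w ∈ A i ∧ ∀ j, j ∈ J ↔ w ∈ C j := by
    simp only [hF, Set.mem_inter_iff, Set.mem_iInter, Set.mem_compl_iff, and_assoc]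
    exact and_congr_right fun _ => ⟨fun h j => ⟨h.1 j, fun hw => by_contra fun hj => h.2 j hj hw⟩,
      fun h => ⟨fun j => (h j).1, fun j hj hw => hj ((h j).2 hw)⟩⟩
  have closure_subset_A (i : Fin (k + 1)) (J : Finset (Fin n)) :
      closure (F i J) ⊆ closure (A i) :=
    closure_mono fun w hw => ((mem_F w i J).1 hw).1
  have closure_subset_C (i : Fin (k + 1)) (J : Finset (Fin n)) (j : Fin n) (hj : j ∈ J) :
      closure (F i J) ⊆ C j :=
    closure_minimal (fun w hw => (((mem_F w i J).1 hw).2 j).1 hj) (hC j)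
  have closure_subset (i : Fin (k + 1)) (J : Finset (Fin n)) :
      closure (F i J) ⊆
        ⋃ (i' : Fin (k + 1)) (_ : i ≤ i') (J' : Finset (Fin n)) (_ : J ⊆ J'), F i' J' := by
    intro w hw
    obtain ⟨i', hi', hwA⟩ := Set.mem_iUnion₂.1 (hclosure i (closure_subset_A i J hw))
    refine Set.mem_iUnion₂.2 ⟨i', hi', Set.mem_iUnion₂.2 
      ⟨Finset.univ.filter fun j => w ∈ C j, fun j hj => ?_, ?_⟩⟩
    · simpa using closure_subset_C i J j hj hw
    · simpa [mem_F] using hwA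
  refine ⟨closure_subset, fun i i' J J' hcard hne => Set.disjoint_left.2 fun w hw hw' => hne ?_⟩
  obtain ⟨i₁, hi₁, hw₁⟩ := Set.mem_iUnion₂.1 (closure_subset i J hw)
  obtain ⟨J₁, hJ₁, hw₁⟩ := Set.mem_iUnion₂.1 hw₁
  rw [mem_F] at hw' hw₁
  obtain rfl : i₁ = i' := by
    by_contra h
    exact Set.disjoint_left.1 (hdisj h) hw₁.1 hw'.1
  obtain rfl : J₁ = J' := Finset.ext fun j => (hw₁.2 j).trans (hw'.2 j).symm
  have hle : (i : ℕ) ≤ i₁ := hi₁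
  have hJ : J = J₁ := Finset.eq_of_subset_of_card_le hJ₁ (by omega)
  subst hJ
  exact Prod.ext (Fin.ext (by simpa using hcard)) rfl
end

section
/- Let C be a commutative ring and let A be a commutative C-algebra, with structure map ι : C → A, which is free as a C-module with basis {1, u} for some u ∈ A, and let e ∈ C satisfy u² = ι(e)·u. Let φ : A → C be a ring homomorphism with φ ∘ ι = id_C and φ(u) = e. Then for every integer k ≥ 0: (i) if e^k ≠ 0 in C then (u − ι(e))^{k+1} ≠ 0 in A; (ii) if e^k = 0 in C then every product of k+1 elements of the kernel of φ is zero. In particular, if m is an integer with e^m ≠ 0 and e^{m+1} = 0, then the maximal length of a nonzero product of elements of ker φ equals m + 1. -/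
theorem sub_algebraMap_pow_succ {C A : Type*} [CommRing C] [CommRing A] [Algebra C A]
    {u : A} {e : C} (hu2 : u ^ 2 = algebraMap C A e * u) (k : ℕ) :
    (u - algebraMap C A e) ^ (k + 1) = algebraMap C A ((-e) ^ k) * (u - algebraMap C A e) := by
  induction k with
  | zero => simp
  | succ k ih =>
    rw [pow_succ, ih]
    simp only [map_pow, map_neg, pow_succ (-(algebraMap C A e)) k]
    linear_combination (-(algebraMap C A e)) ^ k * hu2

theorem prod_eq_zero_of_forall_eq_smul {C A : Type*} [CommRing C] [CommRing A] [Algebra C A]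
    {u : A} {e : C} (hu2 : u ^ 2 = algebraMap C A e * u) {k : ℕ} (hk : e ^ k = 0)
    (f : Fin (k + 1) → A) (hf : ∀ i, ∃ b : C, f i = algebraMap C A b * (u - algebraMap C A e)) :
    ∏ i, f i = 0 := by
  choose b hb using hf
  simp_rw [hb, Finset.prod_mul_distrib]
  rw [Fin.prod_const, sub_algebraMap_pow_succ hu2, neg_pow, hk]
  simp


/-- Algebraic content of Corollary 6.2(C): let `A` be a commutative `C`-algebra, free
as a `C`-module with basis `{1, u}`, with `u² = ι(e)·u`, and let `φ : A → C` be a ring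
homomorphism retracting `ι` with `φ u = e`.  Then: (i) if `e^k ≠ 0` then
`(u - ι e)^(k+1) ≠ 0`; (ii) if `e^k = 0` then every product of `k+1` elements of
`ker φ` vanishes; in particular if `e^m ≠ 0` and `e^(m+1) = 0`, the maximal length of a
nonzero product of elements of `ker φ` equals `m + 1`. -/
theorem cup_length_of_ker_retraction
    {C A : Type*} [CommRing C] [CommRing A] [Algebra C A] (u : A) (e : C)
    (hbasis : ∀ x : A, ∃! ab : C × C, x = algebraMap C A ab.1 + ab.2 • u)
    (hu2 : u ^ 2 = algebraMap C A e * u)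
    (φ : A →+* C) (hφ : ∀ c : C, φ (algebraMap C A c) = c) (hφu : φ u = e) :
    (∀ k : ℕ, e ^ k ≠ 0 → (u - algebraMap C A e) ^ (k + 1) ≠ 0) ∧
    (∀ k : ℕ, e ^ k = 0 →
      ∀ f : Fin (k + 1) → A, (∀ i, φ (f i) = 0) → ∏ i, f i = 0) ∧
    (∀ m : ℕ, e ^ m ≠ 0 → e ^ (m + 1) = 0 →
      (∃ f : Fin (m + 1) → A, (∀ i, φ (f i) = 0) ∧ ∏ i, f i ≠ 0) ∧
      (∀ f : Fin (m + 2) → A, (∀ i, φ (f i) = 0) → ∏ i, f i = 0)) := by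
  have h_ker : ∀ x : A, φ x = 0 → ∃ b : C, x = algebraMap C A b * (u - algebraMap C A e) := by
    intro x hx
    obtain ⟨⟨a, b⟩, h, -⟩ := hbasis x
    rw [Algebra.smul_def] at h
    have hab : a + b * e = 0 := by
      rw [h] at hx
      simpa [hφ, hφu] using hx
    refine ⟨b, ?_⟩
    rw [h, eq_neg_of_add_eq_zero_left hab]
    simp only [map_neg, map_mul]
    ring
  have h_ne : ∀ k : ℕ, e ^ k ≠ 0 → (u - algebraMap C A e) ^ (k + 1) ≠ 0 := by
    intro k hk h0
    rw [sub_algebraMap_pow_succ hu2] at h0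
    have h_coord := (hbasis 0).unique (y₁ := ((-e) ^ k * -e, (-e) ^ k)) (y₂ := (0, 0))
      (by rw [Algebra.smul_def, ← h0]; simp only [map_mul, map_neg]; ring) (by simp)
    have h_neg : (-e) ^ k = 0 := congrArg Prod.snd h_coord
    exact hk (by rw [← neg_neg e, neg_pow, h_neg, mul_zero])
  have h_zero : ∀ k : ℕ, e ^ k = 0 →
      ∀ f : Fin (k + 1) → A, (∀ i, φ (f i) = 0) → ∏ i, f i = 0 :=
    fun k hk f hf => prod_eq_zero_of_forall_eq_smul hu2 hk f fun i => h_ker _ (hf i)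
  refine ⟨h_ne, h_zero, fun m hm hm' => ⟨⟨fun _ => u - algebraMap C A e, ?_, ?_⟩, h_zero _ hm'⟩⟩
  · simp [hφ, hφu]
  · simpa only [Fin.prod_const] using h_ne m hm
end

section
/- Let A be a commutative ring and let A_0 ⊆ A_1 ⊆ … ⊆ A_m = A be a chain of subrings. Suppose that for each i = 1, …, m there are elements v_i ∈ A_i and e_i ∈ A_{i−1} such that every x ∈ A_i has a unique representation x = a + b·v_i with a, b ∈ A_{i−1}. Let φ : A → A be a ring homomorphism whose image is contained in A_0, which satisfies φ(c) = c for all c ∈ A_0 and φ(v_i) = φ(e_i) for all i = 1, …, m. Then the set {x ∈ A : φ(x) = 0} equals the ideal of A generated by v_1 − e_1, …, v_m − e_m. -/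
/-- Algebraic form of the Lemma of Section 7: given a chain of subrings
`S 0 ⊆ S 1 ⊆ … ⊆ S m = A` of a commutative ring `A`, elements `v i ∈ S (i+1)` and
`e i ∈ S i` such that every element of `S (i+1)` has a unique representation
`a + b · v i` with `a, b ∈ S i`, and a ring homomorphism `φ : A → A` with image in
`S 0`, fixing `S 0` pointwise and satisfying `φ (v i) = φ (e i)`, the kernel of `φ` is
the ideal generated by the elements `v i - e i`. -/
theorem ker_diagonal_eq_span_of_leray_hirsch_chain
    {A : Type*} [CommRing A] (m : ℕ) (S : Fin (m + 1) → Subring A)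
    (hchain : Monotone S) (htop : S (Fin.last m) = ⊤)
    (v e : Fin m → A)
    (hv : ∀ i : Fin m, v i ∈ S i.succ)
    (he : ∀ i : Fin m, e i ∈ S i.castSucc)
    (hrep : ∀ i : Fin m, ∀ x ∈ S i.succ,
      ∃! ab : A × A, ab.1 ∈ S i.castSucc ∧ ab.2 ∈ S i.castSucc ∧
        x = ab.1 + ab.2 * v i)
    (φ : A →+* A) (hφrange : ∀ x : A, φ x ∈ S 0)
    (hφid : ∀ c ∈ S 0, φ c = c) (hφv : ∀ i : Fin m, φ (v i) = φ (e i)) :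
    RingHom.ker φ = Ideal.span (Set.range fun i : Fin m => v i - e i) := by
  set I := Ideal.span (Set.range fun i : Fin m => v i - e i) with hI
  refine le_antisymm (fun x hx => ?_) ?_
  · have sub_mem_span : ∀ j : Fin (m + 1), ∀ y ∈ S j, y - φ y ∈ I := by
      intro j
      induction j using Fin.induction with
      | zero =>
        intro y hy
        simp [hφid y hy]
      | succ i ih =>
        intro y hy
        obtain ⟨⟨a, b⟩, ⟨ha, hb, rfl⟩, -⟩ := hrep i y hy
        have hmem : (a - φ a) + (b * e i - φ (b * e i)) + b * (v i - e i) ∈ I :=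
          I.add_mem (I.add_mem (ih a ha) (ih _ (mul_mem hb (he i))))
            (I.mul_mem_left b (Ideal.subset_span ⟨i, rfl⟩))
        convert hmem using 1
        simp only [map_add, map_mul, hφv]
        ring
    have h := sub_mem_span (Fin.last m) x (htop ▸ Subring.mem_top x)
    rwa [(RingHom.mem_ker).1 hx, sub_zero] at h
  · rw [hI, Ideal.span_le]
    rintro _ ⟨i, rfl⟩
    simp [RingHom.mem_ker, hφv]
end

section
/- Let C be a commutative ring in which 2x = 0 implies x = 0, let A be a commutative C-algebra, with structure map ι : C → A, which is free as a C-module with basis {1, u} for some u ∈ A, and let e ∈ C satisfy u² = ι(e)·u. Set a = 2u − ι(e) ∈ A. If m ≥ 0 is an integer with e^m ≠ 0 and e^{m+1} = 0 in C, then, putting h = 2⌊m/2⌋ + 1, one has a^h ≠ 0 and a^{h+1} = 0 in A; in particular the largest integer k with a^k ≠ 0 is the odd number 2⌊m/2⌋ + 1. -/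
/-- If `u² = e u`, then `2u - e` is a square root of `e²`. -/
theorem sq_two_mul_sub_of_sq_eq_mul {A : Type*} [CommRing A] {u e : A} (h : u ^ 2 = e * u) :
    (2 * u - e) ^ 2 = e ^ 2 := by
  linear_combination 4 * h

/-- Algebraic content of Proposition 8.4(b): let `C` be a commutative ring without
2-torsion, `A` a commutative `C`-algebra free as a `C`-module with basis `{1, u}`,
and `e ∈ C` with `u² = ι(e)·u`; set `a = 2u - ι(e)`.  If `e^m ≠ 0` and `e^(m+1) = 0`,
then, with `h = 2⌊m/2⌋ + 1`, one has `a^h ≠ 0` and `a^(h+1) = 0`; in particular the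
largest `k` with `a^k ≠ 0` is the odd number `2⌊m/2⌋ + 1`. -/
theorem height_of_two_u_sub_e
    {C A : Type*} [CommRing C] [CommRing A] [Algebra C A]
    (htors : ∀ x : C, 2 * x = 0 → x = 0) (u : A) (e : C)
    (hbasis : ∀ x : A, ∃! ab : C × C, x = algebraMap C A ab.1 + ab.2 • u)
    (hu2 : u ^ 2 = algebraMap C A e * u)
    (m : ℕ) (hm : e ^ m ≠ 0) (hm1 : e ^ (m + 1) = 0) :
    (2 * u - algebraMap C A e) ^ (2 * (m / 2) + 1) ≠ 0 ∧
    (2 * u - algebraMap C A e) ^ (2 * (m / 2) + 1 + 1) = 0 ∧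
    ∀ k : ℕ, 2 * (m / 2) + 1 < k → (2 * u - algebraMap C A e) ^ k = 0 := by
  have heven (j : ℕ) :
      (2 * u - algebraMap C A e) ^ (2 * j) = algebraMap C A (e ^ (2 * j)) := by
    rw [pow_mul, sq_two_mul_sub_of_sq_eq_mul hu2, ← pow_mul, map_pow]
  have hzero : (2 * u - algebraMap C A e) ^ (2 * (m / 2) + 1 + 1) = 0 := by
    rw [show 2 * (m / 2) + 1 + 1 = 2 * (m / 2 + 1) by ring, heven,
      pow_eq_zero_of_le (by lia) hm1, map_zero]
  refine ⟨fun h => ?_, hzero, fun k hk => pow_eq_zero_of_le hk hzero⟩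
  have hcoord : (0 : A) = algebraMap C A (-e ^ (2 * (m / 2) + 1)) +
      (2 * e ^ (2 * (m / 2))) • u := by
    rw [← h, pow_succ, heven, Algebra.smul_def]
    simp only [map_neg, map_pow, map_mul, map_ofNat]
    ring
  have hpair := (hbasis 0).unique (y₁ := (-e ^ (2 * (m / 2) + 1), 2 * e ^ (2 * (m / 2))))
    (y₂ := (0, 0)) hcoord (by simp)
  exact hm (pow_eq_zero_of_le (Nat.mul_div_le m 2) (htors _ (congrArg Prod.snd hpair)))
end
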